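/- Let (A, ·, ∘) be a cocommutative Hopf brace over a field k and let H be a commutative and cocommutative Hopf algebra over k. Suppose (H, ◀) is a right A∘-module bialgebra (where A∘ denotes the Hopf algebra (A, ∘)) such that x ◀ (a·a') = (x₍₁₎ ◀ a)·S(x₍₂₎)·(x₍₃₎ ◀ a') for all a, a' ∈ A and x ∈ H, where S is the antipode of H. Then the tensor product coalgebra A ⊗ H, equipped with the two multiplications (a ⊗ x)(b ⊗ y) = a·b ⊗ xy and (a ⊗ x) ∘ (b ⊗ y) = (a ∘ b₍₁₎) ⊗ (x ◀ b₍₂₎)y, is a Hopf brace. -/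

import Mathlib

/-! Common definitions for formalizing "Constructing Hopf braces" (Agore). -/

open TensorProduct LinearMap

namespace HopfBraceNL

universe u

variable (k : Type u) [Field k]

section HopfStr

variable (V : Type u) [AddCommGroup V] [Module k V] [Coalgebra k V]

/-- The coalgebra `V` is cocommutative. -/
def IsCocomm : Prop :=
  (TensorProduct.comm k V V).toLinearMap ∘ₗ (Coalgebra.comul (R := k) (A := V)) =
    Coalgebra.comul (R := k) (A := V)

/-- A Hopf algebra structure on the underlying coalgebra of `V`: a multiplication, unit and
antipode making `V` a Hopf algebra whose comultiplication and counit are the given ones. -/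
structure HopfStr where
  mul : V ⊗[k] V →ₗ[k] V
  one : V
  mul_assoc : ∀ a b c : V, mul (mul (a ⊗ₜ[k] b) ⊗ₜ[k] c) = mul (a ⊗ₜ[k] mul (b ⊗ₜ[k] c))
  one_mul : ∀ a : V, mul (one ⊗ₜ[k] a) = a
  mul_one : ∀ a : V, mul (a ⊗ₜ[k] one) = a
  comul_mul : ∀ a b : V,
    Coalgebra.comul (R := k) (mul (a ⊗ₜ[k] b)) =
      TensorProduct.map mul mul
        (TensorProduct.tensorTensorTensorComm k V V V V
          (Coalgebra.comul (R := k) a ⊗ₜ[k] Coalgebra.comul (R := k) b))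
  counit_mul : ∀ a b : V,
    Coalgebra.counit (R := k) (mul (a ⊗ₜ[k] b)) =
      Coalgebra.counit (R := k) a * Coalgebra.counit (R := k) b
  comul_one : Coalgebra.comul (R := k) one = one ⊗ₜ[k] one
  counit_one : Coalgebra.counit (R := k) one = 1
  antipode : V →ₗ[k] V
  antipode_left :
    mul ∘ₗ rTensor V antipode ∘ₗ Coalgebra.comul =
      toSpanSingleton k V one ∘ₗ Coalgebra.counit
  antipode_right :
    mul ∘ₗ lTensor V antipode ∘ₗ Coalgebra.comul =
      toSpanSingleton k V one ∘ₗ Coalgebra.counit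

variable {k V}

/-- The Hopf structure is commutative. -/
def HopfStr.IsComm (hs : HopfStr k V) : Prop :=
  ∀ x y : V, hs.mul (x ⊗ₜ[k] y) = hs.mul (y ⊗ₜ[k] x)

/-- The linear map `x ⊗ y ⊗ z ↦ (x₍₁₎ ∘ y)·S(x₍₂₎)·(x₍₃₎ ∘ z)` (Sweedler notation), the right
hand side of the Hopf brace compatibility condition, written point-free.  Here `m` and `S` are
the multiplication and antipode of the first Hopf structure and `m'` the multiplication of the
second one. -/
noncomputable def braceRHS (m : V ⊗[k] V →ₗ[k] V) (S : V →ₗ[k] V)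
    (m' : V ⊗[k] V →ₗ[k] V) : V ⊗[k] (V ⊗[k] V) →ₗ[k] V :=
  m ∘ₗ lTensor V m
    ∘ₗ TensorProduct.map m' (TensorProduct.map S m')
    ∘ₗ lTensor (V ⊗[k] V) (TensorProduct.assoc k V V V).toLinearMap
    ∘ₗ (TensorProduct.tensorTensorTensorComm k V (V ⊗[k] V) V V).toLinearMap
    ∘ₗ rTensor (V ⊗[k] V)
        ((lTensor V (Coalgebra.comul (R := k))) ∘ₗ (Coalgebra.comul (R := k) (A := V)))

variable (k V) in
/-- A Hopf brace on the coalgebra `V`: two Hopf algebra structures subject to the compatibility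
`x ∘ (y·z) = (x₍₁₎ ∘ y)·S(x₍₂₎)·(x₍₃₎ ∘ z)`. -/
structure HopfBrace where
  dot : HopfStr k V
  circ : HopfStr k V
  brace : circ.mul ∘ₗ lTensor V dot.mul = braceRHS dot.mul dot.antipode circ.mul

/-- A solution of the braid equation on `V ⊗ V`. -/
def SolvesBraid {W : Type u} [AddCommGroup W] [Module k W]
    (c : W ⊗[k] W →ₗ[k] W ⊗[k] W) : Prop :=
  letI c₁ : (W ⊗[k] W) ⊗[k] W →ₗ[k] (W ⊗[k] W) ⊗[k] W := rTensor W c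
  letI c₂ : (W ⊗[k] W) ⊗[k] W →ₗ[k] (W ⊗[k] W) ⊗[k] W :=
    (TensorProduct.assoc k W W W).symm.toLinearMap ∘ₗ lTensor W c ∘ₗ
      (TensorProduct.assoc k W W W).toLinearMap
  c₁ ∘ₗ c₂ ∘ₗ c₁ = c₂ ∘ₗ c₁ ∘ₗ c₂

end HopfStr

section Actions

variable {k}
variable {A H : Type u}
  [AddCommGroup A] [Module k A] [Coalgebra k A]
  [AddCommGroup H] [Module k H] [Coalgebra k H]

/-- `(x, a) ↦ (x₍₁₎ ⊗ a₍₁₎) ⊗ (x₍₂₎ ⊗ a₍₂₎)`, as an element. -/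
noncomputable def split (x : H) (a : A) : (H ⊗[k] A) ⊗[k] (H ⊗[k] A) :=
  TensorProduct.tensorTensorTensorComm k H H A A
    (Coalgebra.comul (R := k) x ⊗ₜ[k] Coalgebra.comul (R := k) a)

/-- `A` is a left module over the Hopf structure `hH` via `act`. -/
structure IsLeftModule (hH : HopfStr k H) (act : H ⊗[k] A →ₗ[k] A) : Prop where
  one_act : ∀ a : A, act (hH.one ⊗ₜ[k] a) = a
  mul_act : ∀ (x y : H) (a : A),
    act (hH.mul (x ⊗ₜ[k] y) ⊗ₜ[k] a) = act (x ⊗ₜ[k] act (y ⊗ₜ[k] a))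

/-- `A` is a left module over `hH`-op via `act`, i.e. `(xy) ▶ a = y ▶ (x ▶ a)`. -/
structure IsLeftOpModule (hH : HopfStr k H) (act : H ⊗[k] A →ₗ[k] A) : Prop where
  one_act : ∀ a : A, act (hH.one ⊗ₜ[k] a) = a
  mul_act : ∀ (x y : H) (a : A),
    act (hH.mul (x ⊗ₜ[k] y) ⊗ₜ[k] a) = act (y ⊗ₜ[k] act (x ⊗ₜ[k] a))

/-- The measuring conditions: `x ▶ (ab) = (x₍₁₎ ▶ a)(x₍₂₎ ▶ b)` and `x ▶ 1 = ε(x)1`. -/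
structure IsModuleAlgebraLaw (hA : HopfStr k A) (act : H ⊗[k] A →ₗ[k] A) : Prop where
  act_mul : ∀ (x : H) (a b : A),
    act (x ⊗ₜ[k] hA.mul (a ⊗ₜ[k] b)) =
      hA.mul (TensorProduct.map act act
        (TensorProduct.tensorTensorTensorComm k H H A A
          (Coalgebra.comul (R := k) x ⊗ₜ[k] (a ⊗ₜ[k] b))))
  act_one : ∀ x : H, act (x ⊗ₜ[k] hA.one) = Coalgebra.counit (R := k) x • hA.one

/-- `act` is a coalgebra map: `Δ(x ▶ a) = (x₍₁₎ ▶ a₍₁₎) ⊗ (x₍₂₎ ▶ a₍₂₎)`,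
`ε(x ▶ a) = ε(x)ε(a)`. -/
structure IsCoalgebraLaw (act : H ⊗[k] A →ₗ[k] A) : Prop where
  comul_act : ∀ (x : H) (a : A),
    Coalgebra.comul (R := k) (act (x ⊗ₜ[k] a)) = TensorProduct.map act act (split x a)
  counit_act : ∀ (x : H) (a : A),
    Coalgebra.counit (R := k) (act (x ⊗ₜ[k] a)) =
      Coalgebra.counit (R := k) x * Coalgebra.counit (R := k) a

/-- `(A, act)` is a left `hH`-module algebra. -/
structure IsLeftModuleAlgebra (hH : HopfStr k H) (hA : HopfStr k A)
    (act : H ⊗[k] A →ₗ[k] A) : Prop where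
  toIsLeftModule : IsLeftModule hH act
  toLaw : IsModuleAlgebraLaw hA act

/-- `(A, act)` is a left `hH`-module coalgebra. -/
structure IsLeftModuleCoalgebra (hH : HopfStr k H) (act : H ⊗[k] A →ₗ[k] A) : Prop where
  toIsLeftModule : IsLeftModule hH act
  toCoalgLaw : IsCoalgebraLaw act

/-- `(A, act)` is a left `hH`-module bialgebra. -/
structure IsLeftModuleBialgebra (hH : HopfStr k H) (hA : HopfStr k A)
    (act : H ⊗[k] A →ₗ[k] A) : Prop where
  toIsLeftModule : IsLeftModule hH act
  toLaw : IsModuleAlgebraLaw hA act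
  toCoalgLaw : IsCoalgebraLaw act

/-- `(A, act)` is a left `hH`-op-module bialgebra. -/
structure IsLeftOpModuleBialgebra (hH : HopfStr k H) (hA : HopfStr k A)
    (act : H ⊗[k] A →ₗ[k] A) : Prop where
  toIsLeftOpModule : IsLeftOpModule hH act
  toLaw : IsModuleAlgebraLaw hA act
  toCoalgLaw : IsCoalgebraLaw act

/-- `H` is a right module over the Hopf structure `hA` via `ract : H ⊗ A → H`. -/
structure IsRightModule (hA : HopfStr k A) (ract : H ⊗[k] A →ₗ[k] H) : Prop where
  act_one : ∀ x : H, ract (x ⊗ₜ[k] hA.one) = x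
  act_mul : ∀ (x : H) (a b : A),
    ract (x ⊗ₜ[k] hA.mul (a ⊗ₜ[k] b)) = ract (ract (x ⊗ₜ[k] a) ⊗ₜ[k] b)

/-- `ract` is a coalgebra map `H ⊗ A → H`. -/
structure IsRightCoalgebraLaw (ract : H ⊗[k] A →ₗ[k] H) : Prop where
  comul_act : ∀ (x : H) (a : A),
    Coalgebra.comul (R := k) (ract (x ⊗ₜ[k] a)) = TensorProduct.map ract ract (split x a)
  counit_act : ∀ (x : H) (a : A),
    Coalgebra.counit (R := k) (ract (x ⊗ₜ[k] a)) =
      Coalgebra.counit (R := k) x * Coalgebra.counit (R := k) a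

/-- `(H, ract)` is a right `hA`-module bialgebra:  in addition to the module and coalgebra
conditions, `(xy) ◁ a = (x ◁ a₍₁₎)(y ◁ a₍₂₎)` and `1 ◁ a = ε(a)1`. -/
structure IsRightModuleBialgebra (hA : HopfStr k A) (hH : HopfStr k H)
    (ract : H ⊗[k] A →ₗ[k] H) : Prop where
  toIsRightModule : IsRightModule hA ract
  mul_ract : ∀ (x y : H) (a : A),
    ract (hH.mul (x ⊗ₜ[k] y) ⊗ₜ[k] a) =
      hH.mul (TensorProduct.map ract ract
        (TensorProduct.tensorTensorTensorComm k H H A A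
          ((x ⊗ₜ[k] y) ⊗ₜ[k] Coalgebra.comul (R := k) a)))
  one_ract : ∀ a : A, ract (hH.one ⊗ₜ[k] a) = Coalgebra.counit (R := k) a • hH.one
  toCoalgLaw : IsRightCoalgebraLaw ract

/-- `(A, H, tri, quad)` is a matched pair of Hopf algebras. -/
structure IsMatchedPair (hA : HopfStr k A) (hH : HopfStr k H)
    (tri : H ⊗[k] A →ₗ[k] A) (quad : H ⊗[k] A →ₗ[k] H) : Prop where
  tri_module : IsLeftModule hH tri
  tri_coalg : IsCoalgebraLaw tri
  quad_module : IsRightModule hA quad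
  quad_coalg : IsRightCoalgebraLaw quad
  mp1 : ∀ x : H, tri (x ⊗ₜ[k] hA.one) = Coalgebra.counit (R := k) x • hA.one
  mp1' : ∀ a : A, quad (hH.one ⊗ₜ[k] a) = Coalgebra.counit (R := k) a • hH.one
  mp2 : ∀ (x : H) (a b : A),
    tri (x ⊗ₜ[k] hA.mul (a ⊗ₜ[k] b)) =
      hA.mul (lTensor A tri (TensorProduct.assoc k A H A
        ((TensorProduct.map tri quad (split x a)) ⊗ₜ[k] b)))
  mp3 : ∀ (x y : H) (a : A),
    quad (hH.mul (x ⊗ₜ[k] y) ⊗ₜ[k] a) =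
      hH.mul (rTensor H quad ((TensorProduct.assoc k H A H).symm
        (x ⊗ₜ[k] TensorProduct.map tri quad (split y a))))
  mp4 : ∀ (x : H) (a : A),
    TensorProduct.map quad tri (split x a) =
      TensorProduct.comm k A H (TensorProduct.map tri quad (split x a))

variable (k) in
/-- `(a ⊗ (u₁ ⊗ u₂)) ⊗ y ↦ mA (a ⊗ u₁) ⊗ mH (u₂ ⊗ y)`: the standard way to assemble
a multiplication on `A ⊗ H` from a middle term `u ∈ A ⊗ H`. -/
noncomputable def sandwich (mA : A ⊗[k] A →ₗ[k] A) (mH : H ⊗[k] H →ₗ[k] H) :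
    (A ⊗[k] (A ⊗[k] H)) ⊗[k] H →ₗ[k] A ⊗[k] H :=
  TensorProduct.map mA mH
    ∘ₗ (TensorProduct.assoc k (A ⊗[k] A) H H).toLinearMap
    ∘ₗ rTensor H (TensorProduct.assoc k A A H).symm.toLinearMap

variable (k) in
/-- `(m ⊗ n) ⊗ p ↦ (m ⊗ p) ⊗ n`. -/
noncomputable def rightComm (M N P : Type u) [AddCommGroup M] [Module k M]
    [AddCommGroup N] [Module k N] [AddCommGroup P] [Module k P] :
    (M ⊗[k] N) ⊗[k] P →ₗ[k] (M ⊗[k] P) ⊗[k] N :=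
  (TensorProduct.assoc k M P N).symm.toLinearMap
    ∘ₗ lTensor M (TensorProduct.comm k N P).toLinearMap
    ∘ₗ (TensorProduct.assoc k M N P).toLinearMap

/-- `(x, b) ↦ (x₍₁₎ ▷ b₍₁₎) ⊗ (x₍₂₎ ◁ b₍₂₎)`. -/
noncomputable def matchedEl (tri : H ⊗[k] A →ₗ[k] A) (quad : H ⊗[k] A →ₗ[k] H)
    (x : H) (b : A) : A ⊗[k] H :=
  TensorProduct.map tri quad (split x b)

/-- `(x, b) ↦ (x₍₁₎ ▷ b) ⊗ x₍₂₎`. -/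
noncomputable def smashEl (tri : H ⊗[k] A →ₗ[k] A) (x : H) (b : A) : A ⊗[k] H :=
  rTensor H tri (rightComm k H H A (Coalgebra.comul (R := k) x ⊗ₜ[k] b))

/-- `(x, b) ↦ b₍₁₎ ⊗ (x ◁ b₍₂₎)`. -/
noncomputable def rsmashEl (ract : H ⊗[k] A →ₗ[k] H) (x : H) (b : A) : A ⊗[k] H :=
  lTensor A ract (TensorProduct.leftComm k H A A (x ⊗ₜ[k] Coalgebra.comul (R := k) b))

end Actions


section Pairing

open Coalgebra (comul counit)

variable {k}
variable {C D X Y Z Z' : Type u}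
  [AddCommGroup C] [Module k C] [Coalgebra k C]
  [AddCommGroup D] [Module k D] [Coalgebra k D]
  [AddCommGroup X] [Module k X] [AddCommGroup Y] [Module k Y]
  [AddCommGroup Z] [Module k Z] [AddCommGroup Z'] [Module k Z']

/-- The linear map `c ↦ f c₍₁₎ ⊗ g c₍₂₎`. -/
noncomputable def linPair (f : C →ₗ[k] X) (g : C →ₗ[k] Y) : C →ₗ[k] X ⊗[k] Y :=
  TensorProduct.map f g ∘ₗ comul

theorem map_comp_linPair (p : X →ₗ[k] Z) (q : Y →ₗ[k] Z') (f : C →ₗ[k] X) (g : C →ₗ[k] Y) :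
    TensorProduct.map p q ∘ₗ linPair f g = linPair (p ∘ₗ f) (q ∘ₗ g) := by
  simp only [linPair, TensorProduct.map_comp, LinearMap.comp_assoc]

theorem assoc_comp_linPair (f : C →ₗ[k] X) (g : C →ₗ[k] Y) (h : C →ₗ[k] Z) :
    (TensorProduct.assoc k X Y Z).toLinearMap ∘ₗ linPair (linPair f g) h =
      linPair f (linPair g h) := by
  simp only [linPair, coassoc_simps]

theorem linPair_linPair_eq_linPair_comul (f : C →ₗ[k] X) (g : C →ₗ[k] Y) (h : C →ₗ[k] Z)
    (l : C →ₗ[k] Z') :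
    linPair (linPair f g) (linPair h l) =
      TensorProduct.map (TensorProduct.map f g) (TensorProduct.map h l) ∘ₗ
        TensorProduct.map comul comul ∘ₗ comul := by
  simp only [linPair, TensorProduct.map_comp, LinearMap.comp_assoc]

theorem tensorTensorTensorComm_comp_linPair [Coalgebra.IsCocomm k C]
    (f : C →ₗ[k] X) (g : C →ₗ[k] Y) (h : C →ₗ[k] Z) (l : C →ₗ[k] Z') :
    (TensorProduct.tensorTensorTensorComm k X Y Z Z').toLinearMap ∘ₗ
        linPair (linPair f g) (linPair h l) =
      linPair (linPair f h) (linPair g l) := by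
  have key : (TensorProduct.tensorTensorTensorComm k C C C C).toLinearMap ∘ₗ
      TensorProduct.map comul comul ∘ₗ comul = TensorProduct.map comul comul ∘ₗ comul (A := C) :=
    (Coalgebra.comulCoalgHom k C).map_comp_comul.symm
  have nat : (TensorProduct.tensorTensorTensorComm k X Y Z Z').toLinearMap ∘ₗ
      TensorProduct.map (TensorProduct.map f g) (TensorProduct.map h l) =
      TensorProduct.map (TensorProduct.map f h) (TensorProduct.map g l) ∘ₗ
        (TensorProduct.tensorTensorTensorComm k C C C C).toLinearMap := by
    ext; simp
  rw [linPair_linPair_eq_linPair_comul, linPair_linPair_eq_linPair_comul, ← LinearMap.comp_assoc,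
    nat, LinearMap.comp_assoc, key]

theorem linPair_toSpanSingleton_apply (f : C →ₗ[k] X) (y : Y) (c : C) :
    linPair f (toSpanSingleton k Y y ∘ₗ counit) c = f c ⊗ₜ[k] y := by
  have h : linPair f (toSpanSingleton k Y y ∘ₗ counit) =
      TensorProduct.map f (toSpanSingleton k Y y) ∘ₗ lTensor C counit ∘ₗ comul := by
    simp only [linPair, LinearMap.lTensor, ← LinearMap.comp_assoc, ← TensorProduct.map_comp,
      LinearMap.comp_id]
  simp [h]

theorem toSpanSingleton_linPair_apply (x : X) (g : C →ₗ[k] Y) (c : C) :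
    linPair (toSpanSingleton k X x ∘ₗ counit) g c = x ⊗ₜ[k] g c := by
  have h : linPair (toSpanSingleton k X x ∘ₗ counit) g =
      TensorProduct.map (toSpanSingleton k X x) g ∘ₗ rTensor C counit ∘ₗ comul := by
    simp only [linPair, LinearMap.rTensor, ← LinearMap.comp_assoc, ← TensorProduct.map_comp,
      LinearMap.comp_id]
  simp [h]

end Pairing

section CoalgHomPairing

open Coalgebra (comul counit)

variable {k}
variable {C D X Y Z Z' : Type u}
  [AddCommGroup C] [Module k C] [Coalgebra k C]
  [AddCommGroup D] [Module k D] [Coalgebra k D]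
  [AddCommGroup X] [Module k X] [Coalgebra k X]
  [AddCommGroup Y] [Module k Y] [Coalgebra k Y]
  [AddCommGroup Z] [Module k Z] [Coalgebra k Z]
  [AddCommGroup Z'] [Module k Z'] [Coalgebra k Z']

theorem coalgHom_ext_linear {f g : D →ₗc[k] X} (h : f.toLinearMap = g.toLinearMap) : f = g :=
  CoalgHom.ext fun d => LinearMap.congr_fun h d

/-- The coalgebra map `c ↦ ε(c) x` for a grouplike element `x`. -/
noncomputable def const (C : Type u) [AddCommGroup C] [Module k C] [Coalgebra k C] (x : X)
    (hΔ : comul (R := k) x = x ⊗ₜ x) (hε : counit (R := k) x = 1) : C →ₗc[k] X where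
  __ := toSpanSingleton k X x ∘ₗ counit
  counit_comp := by ext; simp [hε]
  map_comp_comul := by
    ext c
    have h := toSpanSingleton_linPair_apply (k := k) x (toSpanSingleton k X x ∘ₗ counit) c
    refine h.trans ?_
    simp [hΔ]

@[simp]
theorem const_comp (x : X) (hΔ : comul (R := k) x = x ⊗ₜ x) (hε : counit (R := k) x = 1)
    (f : C →ₗc[k] D) : (const D x hΔ hε).comp f = const C x hΔ hε := by
  refine coalgHom_ext_linear (LinearMap.ext fun c => ?_)
  exact congrArg (toSpanSingleton k X x) (LinearMap.congr_fun f.counit_comp c)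

variable [Coalgebra.IsCocomm k C]

/-- The coalgebra map `c ↦ f c₍₁₎ ⊗ g c₍₂₎` out of a cocommutative coalgebra. -/
noncomputable def pair (f : C →ₗc[k] X) (g : C →ₗc[k] Y) : C →ₗc[k] X ⊗[k] Y :=
  (Coalgebra.TensorProduct.map f g).comp (Coalgebra.comulCoalgHom k C)

theorem pair_apply (f : C →ₗc[k] X) (g : C →ₗc[k] Y) (c : C) :
    pair f g c = linPair f.toLinearMap g.toLinearMap c := rfl

@[simp]
theorem map_comp_pair (p : X →ₗc[k] Z) (q : Y →ₗc[k] Z') (f : C →ₗc[k] X) (g : C →ₗc[k] Y) :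
    (Coalgebra.TensorProduct.map p q).comp (pair f g) = pair (p.comp f) (q.comp g) :=
  coalgHom_ext_linear (map_comp_linPair p.toLinearMap q.toLinearMap f.toLinearMap g.toLinearMap)

@[simp]
theorem assoc_comp_pair (f : C →ₗc[k] X) (g : C →ₗc[k] Y) (h : C →ₗc[k] Z) :
    (Coalgebra.TensorProduct.assoc k k X Y Z : (X ⊗[k] Y) ⊗[k] Z →ₗc[k] X ⊗[k] (Y ⊗[k] Z)).comp
      (pair (pair f g) h) = pair f (pair g h) :=
  coalgHom_ext_linear (assoc_comp_linPair f.toLinearMap g.toLinearMap h.toLinearMap)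

@[simp]
theorem assoc_symm_comp_pair (f : C →ₗc[k] X) (g : C →ₗc[k] Y) (h : C →ₗc[k] Z) :
    ((Coalgebra.TensorProduct.assoc k k X Y Z).symm :
        X ⊗[k] (Y ⊗[k] Z) →ₗc[k] (X ⊗[k] Y) ⊗[k] Z).comp
      (pair f (pair g h)) = pair (pair f g) h := by
  rw [← assoc_comp_pair]
  exact CoalgHom.ext fun c => (Coalgebra.TensorProduct.assoc k k X Y Z).symm_apply_apply _

variable (k X Y Z Z') in
/-- The middle-four interchange as a coalgebra map. -/
noncomputable def interchange :
    (X ⊗[k] Y) ⊗[k] (Z ⊗[k] Z') →ₗc[k] (X ⊗[k] Z) ⊗[k] (Y ⊗[k] Z') where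
  __ := (TensorProduct.tensorTensorTensorComm k X Y Z Z').toLinearMap
  counit_comp := by
    ext x y z w
    simp [mul_comm, mul_left_comm, mul_assoc]
  map_comp_comul := by
    ext x y z w
    simp only [AlgebraTensorModule.curry_apply, curry_apply, LinearMap.coe_restrictScalars,
      LinearMap.coe_comp, Function.comp_apply, TensorProduct.comul_tmul, LinearEquiv.coe_coe,
      TensorProduct.tensorTensorTensorComm_tmul]
    generalize comul (R := k) x = x'
    generalize comul (R := k) y = y'
    generalize comul (R := k) z = z'
    generalize comul (R := k) w = w'
    induction x' with
    | zero => simp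
    | add a b ha hb => simp only [add_tmul, map_add, ha, hb]
    | tmul x₁ x₂ =>
    induction y' with
    | zero => simp
    | add a b ha hb => simp only [add_tmul, tmul_add, map_add, ha, hb]
    | tmul y₁ y₂ =>
    induction z' with
    | zero => simp
    | add a b ha hb => simp only [add_tmul, tmul_add, map_add, ha, hb]
    | tmul z₁ z₂ =>
    induction w' with
    | zero => simp
    | add a b ha hb => simp only [tmul_add, map_add, ha, hb]
    | tmul w₁ w₂ => simp

@[simp]
theorem interchange_comp_pair (f : C →ₗc[k] X) (g : C →ₗc[k] Y) (h : C →ₗc[k] Z)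
    (l : C →ₗc[k] Z') :
    (interchange k X Y Z Z').comp (pair (pair f g) (pair h l)) = pair (pair f h) (pair g l) :=
  coalgHom_ext_linear (tensorTensorTensorComm_comp_linPair _ _ _ _)

@[simp]
theorem comul_comp [Coalgebra.IsCocomm k X] (f : C →ₗc[k] X) :
    (Coalgebra.comulCoalgHom k X).comp f = pair f f :=
  coalgHom_ext_linear f.map_comp_comul.symm

@[simp]
theorem pair_comp [Coalgebra.IsCocomm k D] (f : D →ₗc[k] X) (g : D →ₗc[k] Y) (h : C →ₗc[k] D) :
    (pair f g).comp h = pair (f.comp h) (g.comp h) := by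
  rw [← map_comp_pair, ← comul_comp, pair, CoalgHom.comp_assoc]

variable (k X Y) in
/-- The projection `x ⊗ y ↦ ε(y) x`. -/
noncomputable def fst : X ⊗[k] Y →ₗc[k] X :=
  (Coalgebra.TensorProduct.rid k k X : X ⊗[k] k →ₗc[k] X).comp
    (Coalgebra.TensorProduct.map (CoalgHom.id k X) (Coalgebra.counitCoalgHom k Y))

variable (k X Y) in
/-- The projection `x ⊗ y ↦ ε(x) y`. -/
noncomputable def snd : X ⊗[k] Y →ₗc[k] Y :=
  (Coalgebra.TensorProduct.lid k Y : k ⊗[k] Y →ₗc[k] Y).comp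
    (Coalgebra.TensorProduct.map (Coalgebra.counitCoalgHom k X) (CoalgHom.id k Y))

@[simp]
theorem fst_comp_pair (f : C →ₗc[k] X) (g : C →ₗc[k] Y) : (fst k X Y).comp (pair f g) = f := by
  have h : (Coalgebra.counitCoalgHom k Y).toLinearMap ∘ₗ g.toLinearMap =
      toSpanSingleton k k 1 ∘ₗ counit := by
    ext c; simp
  ext c
  have := LinearMap.congr_fun (map_comp_linPair (CoalgHom.id k X).toLinearMap
    (Coalgebra.counitCoalgHom k Y).toLinearMap f.toLinearMap g.toLinearMap) c
  rw [h, linPair_toSpanSingleton_apply] at this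
  exact (congrArg (TensorProduct.rid k X) this).trans (by simp)

@[simp]
theorem snd_comp_pair (f : C →ₗc[k] X) (g : C →ₗc[k] Y) : (snd k X Y).comp (pair f g) = g := by
  have h : (Coalgebra.counitCoalgHom k X).toLinearMap ∘ₗ f.toLinearMap =
      toSpanSingleton k k 1 ∘ₗ counit := by
    ext c; simp
  ext c
  have := LinearMap.congr_fun (map_comp_linPair (Coalgebra.counitCoalgHom k X).toLinearMap
    (CoalgHom.id k Y).toLinearMap f.toLinearMap g.toLinearMap) c
  rw [h, toSpanSingleton_linPair_apply] at this
  exact (congrArg (TensorProduct.lid k Y) this).trans (by simp)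

theorem pair_fst_snd [Coalgebra.IsCocomm k X] [Coalgebra.IsCocomm k Y] :
    pair (fst k X Y) (snd k X Y) = CoalgHom.id k (X ⊗[k] Y) := by
  refine coalgHom_ext_linear (TensorProduct.ext' fun x y => ?_)
  have h : ∀ (s : X ⊗[k] X) (t : Y ⊗[k] Y),
      TensorProduct.map (fst k X Y).toLinearMap (snd k X Y).toLinearMap
        (TensorProduct.tensorTensorTensorComm k X X Y Y (s ⊗ₜ t)) =
      TensorProduct.map (TensorProduct.rid k X).toLinearMap (TensorProduct.lid k Y).toLinearMap
        (lTensor X counit s ⊗ₜ rTensor Y counit t) := by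
    intro s t
    induction s with
    | zero => simp
    | add a b ha hb => simp only [add_tmul, map_add, ha, hb]
    | tmul x₁ x₂ =>
    induction t with
    | zero => simp
    | add a b ha hb => simp only [tmul_add, map_add, ha, hb]
    | tmul y₁ y₂ =>
    have e₁ : fst k X Y (x₁ ⊗ₜ y₁) = counit (R := k) y₁ • x₁ := rfl
    have e₂ : snd k X Y (x₂ ⊗ₜ y₂) = counit (R := k) x₂ • y₂ := rfl
    simp [e₁, e₂, TensorProduct.smul_tmul, TensorProduct.tmul_smul,
      smul_comm (counit (R := k) x₂)]
  refine (h (comul x) (comul y)).trans ?_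
  simp

theorem eq_pair [Coalgebra.IsCocomm k X] [Coalgebra.IsCocomm k Y] (f : C →ₗc[k] X ⊗[k] Y) :
    f = pair ((fst k X Y).comp f) ((snd k X Y).comp f) := by
  rw [← pair_comp, pair_fst_snd, CoalgHom.id_comp]

theorem coalgHom_ext_of_comp_pair [Coalgebra.IsCocomm k X] [Coalgebra.IsCocomm k Y]
    {f g : X ⊗[k] Y →ₗc[k] D}
    (h : ∀ (p : X ⊗[k] Y →ₗc[k] X) (q : X ⊗[k] Y →ₗc[k] Y),
      f.comp (pair p q) = g.comp (pair p q)) :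
    f = g := by
  simpa only [pair_fst_snd, CoalgHom.comp_id] using h (fst k X Y) (snd k X Y)

theorem pair_const_apply (f : C →ₗc[k] X) (y : Y) (hΔ : comul (R := k) y = y ⊗ₜ y)
    (hε : counit (R := k) y = 1) (c : C) : pair f (const C y hΔ hε) c = f c ⊗ₜ y :=
  linPair_toSpanSingleton_apply f.toLinearMap y c

theorem const_pair_apply (x : X) (hΔ : comul (R := k) x = x ⊗ₜ x)
    (hε : counit (R := k) x = 1) (g : C →ₗc[k] Y) (c : C) :
    pair (const C x hΔ hε) g c = x ⊗ₜ g c :=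
  toSpanSingleton_linPair_apply x g.toLinearMap c

theorem pair_const_const (x : X) (hΔ : comul (R := k) x = x ⊗ₜ x) (hε : counit (R := k) x = 1)
    (y : Y) (hΔ' : comul (R := k) y = y ⊗ₜ y) (hε' : counit (R := k) y = 1)
    (hΔ'' : comul (R := k) (x ⊗ₜ[k] y) = (x ⊗ₜ y) ⊗ₜ (x ⊗ₜ y))
    (hε'' : counit (R := k) (x ⊗ₜ[k] y) = 1) :
    pair (const C x hΔ hε) (const C y hΔ' hε') = const C (x ⊗ₜ y) hΔ'' hε'' := by
  refine CoalgHom.ext fun c => ?_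
  rw [const_pair_apply]
  exact TensorProduct.tmul_smul _ _ _

end CoalgHomPairing

section Points

open Coalgebra (comul counit)

variable {k}
variable {C V : Type u}
  [AddCommGroup C] [Module k C] [Coalgebra k C]
  [AddCommGroup V] [Module k V] [Coalgebra k V]

theorem isCocomm_of_isCocomm (h : IsCocomm k V) : Coalgebra.IsCocomm k V := ⟨h⟩

/-- One-sided convolution inverses on either side agree. -/
theorem eq_of_linPair_eq_const {X : Type u} [AddCommGroup X] [Module k X]
    (m : X ⊗[k] X →ₗ[k] X) (e : X)
    (hassoc : m ∘ₗ TensorProduct.map m LinearMap.id =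
      m ∘ₗ TensorProduct.map LinearMap.id m ∘ₗ (TensorProduct.assoc k X X X).toLinearMap)
    (hone : ∀ x, m (e ⊗ₜ x) = x) (hone' : ∀ x, m (x ⊗ₜ e) = x)
    {f g h : C →ₗ[k] X} (hfg : m ∘ₗ linPair f g = toSpanSingleton k X e ∘ₗ counit)
    (hgh : m ∘ₗ linPair g h = toSpanSingleton k X e ∘ₗ counit) : f = h := by
  have h₁ : m ∘ₗ linPair (m ∘ₗ linPair f g) h = m ∘ₗ linPair f (m ∘ₗ linPair g h) := by
    have := congrArg (· ∘ₗ linPair (linPair f g) h) hassoc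
    simpa only [LinearMap.comp_assoc, assoc_comp_linPair, map_comp_linPair, LinearMap.id_comp]
      using this
  ext c
  have := LinearMap.congr_fun h₁ c
  rw [hfg, hgh] at this
  simpa only [LinearMap.comp_apply, toSpanSingleton_linPair_apply, linPair_toSpanSingleton_apply,
    hone, hone'] using this.symm

namespace HopfStr

variable (hs : HopfStr k V)

/-- The multiplication of a Hopf structure as a coalgebra map. -/
noncomputable def mulHom : V ⊗[k] V →ₗc[k] V where
  __ := hs.mul
  counit_comp := TensorProduct.ext' fun a b => by
    simpa [mul_comm] using hs.counit_mul a b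
  map_comp_comul := TensorProduct.ext' fun a b => (hs.comul_mul a b).symm

/-- The constant coalgebra map at the unit. -/
noncomputable def unit (C : Type u) [AddCommGroup C] [Module k C] [Coalgebra k C] : C →ₗc[k] V :=
  const C hs.one hs.comul_one hs.counit_one

@[simp]
theorem unit_comp {D : Type u} [AddCommGroup D] [Module k D] [Coalgebra k D]
    [Coalgebra.IsCocomm k C] (f : C →ₗc[k] D) : (hs.unit D).comp f = hs.unit C :=
  const_comp _ _ _ f

theorem counit_antipode (v : V) : counit (R := k) (hs.antipode v) = counit (R := k) v := by
  have h₁ := congrArg (counit (R := k)) (LinearMap.congr_fun hs.antipode_left v)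
  have h₂ : ∀ t : V ⊗[k] V, counit (R := k) (hs.mul (rTensor V hs.antipode t)) =
      counit (R := k) (hs.antipode (TensorProduct.rid k V (lTensor V counit t))) := by
    intro t
    induction t with
    | zero => simp
    | add a b ha hb => simp only [map_add, ha, hb]
    | tmul a b => simp [hs.counit_mul, mul_comm]
  simpa [h₂, hs.counit_one] using h₁

theorem comul_comp_antipode [Coalgebra.IsCocomm k V] :
    comul ∘ₗ hs.antipode = linPair hs.antipode hs.antipode := by
  have hmul : hs.mul ∘ₗ linPair hs.antipode LinearMap.id =
      toSpanSingleton k V hs.one ∘ₗ counit := hs.antipode_left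
  have hmul' : hs.mul ∘ₗ linPair LinearMap.id hs.antipode =
      toSpanSingleton k V hs.one ∘ₗ counit := hs.antipode_right
  refine eq_of_linPair_eq_const
    (TensorProduct.map hs.mul hs.mul ∘ₗ
      (TensorProduct.tensorTensorTensorComm k V V V V).toLinearMap) (hs.one ⊗ₜ hs.one)
    ?_ (fun x => ?_) (fun x => ?_) (g := comul) ?_ ?_
  · ext
    simp [hs.mul_assoc]
  · induction x with
    | zero => simp
    | add a b ha hb => simp only [tmul_add, map_add, ha, hb]
    | tmul a b => simp [hs.one_mul]
  · induction x with
    | zero => simp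
    | add a b ha hb => simp only [add_tmul, map_add, ha, hb]
    | tmul a b => simp [hs.mul_one]
  · have h : (TensorProduct.map hs.mul hs.mul ∘ₗ
        (TensorProduct.tensorTensorTensorComm k V V V V).toLinearMap) ∘ₗ
        TensorProduct.map comul comul = comul ∘ₗ hs.mul := hs.mulHom.map_comp_comul
    have h' : linPair (comul ∘ₗ hs.antipode) comul =
        TensorProduct.map comul comul ∘ₗ linPair hs.antipode (LinearMap.id (R := k) (M := V)) := by
      rw [map_comp_linPair, LinearMap.comp_id]
    rw [h', ← LinearMap.comp_assoc, h, LinearMap.comp_assoc, hmul]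
    ext v
    simp [hs.comul_one]
  · have h : (comul : V →ₗ[k] _) = linPair LinearMap.id LinearMap.id := by
      simp [linPair]
    rw [h, LinearMap.comp_assoc, tensorTensorTensorComm_comp_linPair, map_comp_linPair, hmul']
    ext v
    rw [linPair_toSpanSingleton_apply]
    exact TensorProduct.smul_tmul' _ _ _

/-- The antipode of a cocommutative Hopf structure as a coalgebra map. -/
noncomputable def antipodeHom [Coalgebra.IsCocomm k V] : V →ₗc[k] V where
  __ := hs.antipode
  counit_comp := LinearMap.ext hs.counit_antipode
  map_comp_comul := hs.comul_comp_antipode.symm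

variable [Coalgebra.IsCocomm k C]

/-- The convolution product of two coalgebra maps. -/
noncomputable def conv (f g : C →ₗc[k] V) : C →ₗc[k] V := hs.mulHom.comp (pair f g)

@[simp]
theorem mulHom_comp_pair (f g : C →ₗc[k] V) : hs.mulHom.comp (pair f g) = hs.conv f g := rfl

@[simp]
theorem conv_comp {D : Type u} [AddCommGroup D] [Module k D] [Coalgebra k D]
    [Coalgebra.IsCocomm k D] (f g : C →ₗc[k] V) (h : D →ₗc[k] C) :
    (hs.conv f g).comp h = hs.conv (f.comp h) (g.comp h) := by
  rw [conv, CoalgHom.comp_assoc, pair_comp, mulHom_comp_pair]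

theorem conv_unit (f : C →ₗc[k] V) : hs.conv f (hs.unit C) = f :=
  CoalgHom.ext fun c => (congrArg hs.mul (pair_const_apply f _ _ _ c)).trans (hs.mul_one _)

theorem unit_conv (f : C →ₗc[k] V) : hs.conv (hs.unit C) f = f :=
  CoalgHom.ext fun c => (congrArg hs.mul (const_pair_apply _ _ _ f c)).trans (hs.one_mul _)

theorem conv_assoc (f g h : C →ₗc[k] V) :
    hs.conv (hs.conv f g) h = hs.conv f (hs.conv g h) := by
  have key : hs.mulHom.comp (Coalgebra.TensorProduct.map hs.mulHom (CoalgHom.id k V)) =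
      (hs.mulHom.comp (Coalgebra.TensorProduct.map (CoalgHom.id k V) hs.mulHom)).comp
        (Coalgebra.TensorProduct.assoc k k V V V : _ →ₗc[k] _) :=
    coalgHom_ext_linear (TensorProduct.ext_threefold hs.mul_assoc)
  simpa [CoalgHom.comp_assoc] using congrArg (·.comp (pair (pair f g) h)) key

theorem conv_comm (hc : hs.IsComm) (f g : C →ₗc[k] V) : hs.conv f g = hs.conv g f := by
  have hcomm : hs.mul ∘ₗ (TensorProduct.comm k V V).toLinearMap = hs.mul :=
    TensorProduct.ext' fun a b => hc b a
  refine CoalgHom.ext fun c => ?_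
  have h : (TensorProduct.comm k V V).toLinearMap ∘ₗ linPair f.toLinearMap g.toLinearMap =
      linPair g.toLinearMap f.toLinearMap := by
    conv_rhs => rw [linPair, ← Coalgebra.comm_comp_comul]
    rw [linPair, ← LinearMap.comp_assoc, ← LinearMap.comp_assoc, TensorProduct.map_comp_comm_eq]
  exact (LinearMap.congr_fun hcomm _).symm.trans (congrArg hs.mul (LinearMap.congr_fun h c))

variable [Coalgebra.IsCocomm k V]

theorem antipode_conv (f : C →ₗc[k] V) : hs.conv (hs.antipodeHom.comp f) f = hs.unit C := by
  have h : hs.conv hs.antipodeHom (CoalgHom.id k V) = hs.unit V :=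
    coalgHom_ext_linear hs.antipode_left
  simpa using congrArg (·.comp f) h

theorem conv_antipode (f : C →ₗc[k] V) : hs.conv f (hs.antipodeHom.comp f) = hs.unit C := by
  have h : hs.conv (CoalgHom.id k V) hs.antipodeHom = hs.unit V :=
    coalgHom_ext_linear hs.antipode_right
  simpa using congrArg (·.comp f) h

/-- A Hopf structure from coalgebra maps satisfying the group laws on points. -/
noncomputable def ofPoints (m : V ⊗[k] V →ₗc[k] V) (e : V)
    (hΔ : comul (R := k) e = e ⊗ₜ e) (hε : counit (R := k) e = 1) (S : V →ₗc[k] V)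
    (hassoc : ∀ p q r : (V ⊗[k] V) ⊗[k] V →ₗc[k] V,
      m.comp (pair (m.comp (pair p q)) r) = m.comp (pair p (m.comp (pair q r))))
    (hone : ∀ p : V →ₗc[k] V, m.comp (pair (const V e hΔ hε) p) = p)
    (hone' : ∀ p : V →ₗc[k] V, m.comp (pair p (const V e hΔ hε)) = p)
    (hinv : ∀ p : V →ₗc[k] V, m.comp (pair (S.comp p) p) = const V e hΔ hε)
    (hinv' : ∀ p : V →ₗc[k] V, m.comp (pair p (S.comp p)) = const V e hΔ hε) :
    HopfStr k V where
  mul := m.toLinearMap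
  one := e
  mul_assoc a b c := by
    have key : m.comp (Coalgebra.TensorProduct.map m (CoalgHom.id k V)) =
        (m.comp (Coalgebra.TensorProduct.map (CoalgHom.id k V) m)).comp
          (Coalgebra.TensorProduct.assoc k k V V V : _ →ₗc[k] _) := by
      refine coalgHom_ext_of_comp_pair fun p r => ?_
      rw [eq_pair p]
      simpa [CoalgHom.comp_assoc] using hassoc _ _ _
    exact CoalgHom.congr_fun key ((a ⊗ₜ b) ⊗ₜ c)
  one_mul a := by
    simpa [const_pair_apply] using CoalgHom.congr_fun (hone (CoalgHom.id k V)) a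
  mul_one a := by
    simpa [pair_const_apply] using CoalgHom.congr_fun (hone' (CoalgHom.id k V)) a
  comul_mul a b := (LinearMap.congr_fun m.map_comp_comul (a ⊗ₜ b)).symm
  counit_mul a b := by
    simp [mul_comm]
  comul_one := hΔ
  counit_one := hε
  antipode := S.toLinearMap
  antipode_left := congrArg CoalgHom.toLinearMap (hinv (CoalgHom.id k V))
  antipode_right := congrArg CoalgHom.toLinearMap (hinv' (CoalgHom.id k V))

end HopfStr

variable [Coalgebra.IsCocomm k V]

/-- `braceRHS` as a coalgebra map. -/
noncomputable def braceRHSHom (dot circ : HopfStr k V) : V ⊗[k] (V ⊗[k] V) →ₗc[k] V :=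
  dot.mulHom.comp <| (Coalgebra.TensorProduct.map (CoalgHom.id k V) dot.mulHom).comp <|
    (Coalgebra.TensorProduct.map circ.mulHom
      (Coalgebra.TensorProduct.map dot.antipodeHom circ.mulHom)).comp <|
    (Coalgebra.TensorProduct.map (CoalgHom.id k (V ⊗[k] V))
      (Coalgebra.TensorProduct.assoc k k V V V : _ →ₗc[k] _)).comp <|
    (interchange k V (V ⊗[k] V) V V).comp <|
      Coalgebra.TensorProduct.map
        ((Coalgebra.TensorProduct.map (CoalgHom.id k V) (Coalgebra.comulCoalgHom k V)).comp
          (Coalgebra.comulCoalgHom k V)) (CoalgHom.id k (V ⊗[k] V))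

variable [Coalgebra.IsCocomm k C]

theorem braceRHSHom_comp_pair (dot circ : HopfStr k V) (p q r : C →ₗc[k] V) :
    (braceRHSHom dot circ).comp (pair p (pair q r)) =
      dot.conv (circ.conv p q) (dot.conv (dot.antipodeHom.comp p) (circ.conv p r)) := by
  simp [braceRHSHom, CoalgHom.comp_assoc]

theorem HopfBrace.conv_brace (B : HopfBrace k V) (p q r : C →ₗc[k] V) :
    B.circ.conv p (B.dot.conv q r) = B.dot.conv (B.circ.conv p q)
      (B.dot.conv (B.dot.antipodeHom.comp p) (B.circ.conv p r)) := by
  have h : B.circ.mulHom.comp (Coalgebra.TensorProduct.map (CoalgHom.id k V) B.dot.mulHom) =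
      braceRHSHom B.dot B.circ := coalgHom_ext_linear B.brace
  rw [← braceRHSHom_comp_pair, ← h]
  simp [CoalgHom.comp_assoc]

/-- A Hopf brace from two Hopf structures satisfying the brace identity on points. -/
noncomputable def HopfBrace.ofPoints (dot circ : HopfStr k V)
    (h : ∀ p q r : V ⊗[k] (V ⊗[k] V) →ₗc[k] V,
      circ.conv p (dot.conv q r) = dot.conv (circ.conv p q)
        (dot.conv (dot.antipodeHom.comp p) (circ.conv p r))) : HopfBrace k V where
  dot := dot
  circ := circ
  brace := by
    refine congrArg CoalgHom.toLinearMap (show circ.mulHom.comp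
      (Coalgebra.TensorProduct.map (CoalgHom.id k V) dot.mulHom) = braceRHSHom dot circ from ?_)
    refine coalgHom_ext_of_comp_pair fun p q => ?_
    rw [eq_pair q, braceRHSHom_comp_pair, ← h]
    simp [CoalgHom.comp_assoc]

end Points

section SemidirectProduct

open Coalgebra (comul counit)

variable {k}
variable {C A H : Type u}
  [AddCommGroup C] [Module k C] [Coalgebra k C] [Coalgebra.IsCocomm k C]
  [AddCommGroup A] [Module k A] [Coalgebra k A]
  [AddCommGroup H] [Module k H] [Coalgebra k H]

variable (k) in
/-- `((x ⊗ y) ⊗ z) ⊗ (a ⊗ b) ↦ ((x ⊗ a) ⊗ y) ⊗ (z ⊗ b)` as a coalgebra map. -/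
noncomputable def spreadAux (H A : Type u)
    [AddCommGroup A] [Module k A] [Coalgebra k A] [AddCommGroup H] [Module k H] [Coalgebra k H] :
    ((H ⊗[k] H) ⊗[k] H) ⊗[k] (A ⊗[k] A) →ₗc[k] ((H ⊗[k] A) ⊗[k] H) ⊗[k] (H ⊗[k] A) :=
  (Coalgebra.TensorProduct.map
    (((Coalgebra.TensorProduct.map (CoalgHom.id k (H ⊗[k] A))
        (Coalgebra.TensorProduct.rid k k H : _ →ₗc[k] _)).comp (interchange k H H A k)).comp
      (Coalgebra.TensorProduct.map (CoalgHom.id k (H ⊗[k] H))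
        ((Coalgebra.TensorProduct.rid k k A).symm : _ →ₗc[k] _)))
    (CoalgHom.id k (H ⊗[k] A))).comp (interchange k (H ⊗[k] H) H A A)

theorem spreadAux_tmul (x y z : H) (a b : A) :
    spreadAux k H A (((x ⊗ₜ y) ⊗ₜ z) ⊗ₜ (a ⊗ₜ b)) = ((x ⊗ₜ a) ⊗ₜ y) ⊗ₜ (z ⊗ₜ b) := by
  have h : spreadAux k H A (((x ⊗ₜ y) ⊗ₜ z) ⊗ₜ (a ⊗ₜ b)) =
    ((x ⊗ₜ a) ⊗ₜ ((1 : k) • y)) ⊗ₜ (z ⊗ₜ b) := rfl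
  rw [h, one_smul]

variable (k) in
/-- `x ⊗ (a ⊗ b) ↦ ((x₍₁₎ ⊗ a) ⊗ x₍₂₎) ⊗ (x₍₃₎ ⊗ b)` as a coalgebra map. -/
noncomputable def spread (H A : Type u)
    [AddCommGroup A] [Module k A] [Coalgebra k A]
    [AddCommGroup H] [Module k H] [Coalgebra k H] [Coalgebra.IsCocomm k H] :
    H ⊗[k] (A ⊗[k] A) →ₗc[k] ((H ⊗[k] A) ⊗[k] H) ⊗[k] (H ⊗[k] A) :=
  (spreadAux k H A).comp <|
    Coalgebra.TensorProduct.map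
      ((Coalgebra.TensorProduct.map (Coalgebra.comulCoalgHom k H) (CoalgHom.id k H)).comp
        (Coalgebra.comulCoalgHom k H)) (CoalgHom.id k (A ⊗[k] A))

theorem rid_symm_comp (a : C →ₗc[k] A) :
    ((Coalgebra.TensorProduct.rid k k A).symm : A →ₗc[k] A ⊗[k] k).comp a =
      pair a (Coalgebra.counitCoalgHom k C) := by
  have h : (Coalgebra.counitCoalgHom k C).toLinearMap = toSpanSingleton k k 1 ∘ₗ counit := by
    ext c; simp
  refine CoalgHom.ext fun c => ?_
  rw [pair_apply, h, linPair_toSpanSingleton_apply]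
  rfl

theorem rid_comp_pair (a : C →ₗc[k] A) :
    (Coalgebra.TensorProduct.rid k k A : A ⊗[k] k →ₗc[k] A).comp
      (pair a (Coalgebra.counitCoalgHom k C)) = a := by
  rw [← rid_symm_comp]
  exact CoalgHom.ext fun c => (Coalgebra.TensorProduct.rid k k A).apply_symm_apply _

theorem spread_comp_pair [Coalgebra.IsCocomm k H] (x : C →ₗc[k] H)
    (a b : C →ₗc[k] A) :
    (spread k H A).comp (pair x (pair a b)) = pair (pair (pair x a) x) (pair x b) := by
  simp [spread, spreadAux, CoalgHom.comp_assoc, rid_symm_comp, rid_comp_pair]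

namespace IsRightModuleBialgebra

variable {hA : HopfStr k A} {hH : HopfStr k H} {ract : H ⊗[k] A →ₗ[k] H}
  (h : IsRightModuleBialgebra hA hH ract)

/-- The action of a module bialgebra as a coalgebra map. -/
noncomputable def actHom : H ⊗[k] A →ₗc[k] H where
  __ := ract
  counit_comp := TensorProduct.ext' fun x a => by
    simpa [mul_comm] using h.toCoalgLaw.counit_act x a
  map_comp_comul := TensorProduct.ext' fun x a => (h.toCoalgLaw.comul_act x a).symm

/-- The action of a module bialgebra on points. -/
noncomputable def act (x : C →ₗc[k] H) (a : C →ₗc[k] A) : C →ₗc[k] H :=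
  h.actHom.comp (pair x a)

@[simp]
theorem actHom_comp_pair (x : C →ₗc[k] H) (a : C →ₗc[k] A) :
    h.actHom.comp (pair x a) = h.act x a := rfl

@[simp]
theorem act_comp {D : Type u} [AddCommGroup D] [Module k D] [Coalgebra k D]
    [Coalgebra.IsCocomm k D] (x : C →ₗc[k] H) (a : C →ₗc[k] A) (f : D →ₗc[k] C) :
    (h.act x a).comp f = h.act (x.comp f) (a.comp f) := by
  rw [act, CoalgHom.comp_assoc, pair_comp, actHom_comp_pair]

theorem act_unit (x : C →ₗc[k] H) : h.act x (hA.unit C) = x :=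
  CoalgHom.ext fun c => (congrArg ract (pair_const_apply x _ _ _ c)).trans
    (h.toIsRightModule.act_one _)

theorem unit_act (a : C →ₗc[k] A) : h.act (hH.unit C) a = hH.unit C := by
  refine CoalgHom.ext fun c => (congrArg ract (const_pair_apply _ _ _ a c)).trans
    ((h.one_ract _).trans ?_)
  exact congrArg (· • hH.one) (LinearMap.congr_fun a.counit_comp c)

theorem act_conv (x : C →ₗc[k] H) (a b : C →ₗc[k] A) :
    h.act x (hA.conv a b) = h.act (h.act x a) b := by
  have key : (h.actHom.comp
      (Coalgebra.TensorProduct.map (CoalgHom.id k H) hA.mulHom)).comp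
        (Coalgebra.TensorProduct.assoc k k H A A : _ →ₗc[k] _) =
      h.actHom.comp
        (Coalgebra.TensorProduct.map h.actHom (CoalgHom.id k A)) :=
    coalgHom_ext_linear (TensorProduct.ext_threefold h.toIsRightModule.act_mul)
  simpa [CoalgHom.comp_assoc] using congrArg (·.comp (pair (pair x a) b)) key

theorem conv_act [Coalgebra.IsCocomm k A] (x y : C →ₗc[k] H) (a : C →ₗc[k] A) :
    h.act (hH.conv x y) a = hH.conv (h.act x a) (h.act y a) := by
  have key : h.actHom.comp
      (Coalgebra.TensorProduct.map hH.mulHom (CoalgHom.id k A)) =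
      hH.mulHom.comp ((Coalgebra.TensorProduct.map h.actHom h.actHom).comp
        ((interchange k H H A A).comp
          (Coalgebra.TensorProduct.map (CoalgHom.id k (H ⊗[k] H))
            (Coalgebra.comulCoalgHom k A)))) :=
    coalgHom_ext_linear (TensorProduct.ext_threefold h.mul_ract)
  simpa [CoalgHom.comp_assoc] using congrArg (·.comp (pair (pair x y) a)) key

/-- The multiplication `(a ⊗ x)(b ⊗ y) = a b₍₁₎ ⊗ (x ◀ b₍₂₎) y` as a coalgebra map. -/
noncomputable def smashMul [Coalgebra.IsCocomm k A] : (A ⊗[k] H) ⊗[k] (A ⊗[k] H) →ₗc[k] A ⊗[k] H :=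
  (Coalgebra.TensorProduct.map hA.mulHom hH.mulHom).comp <|
  (Coalgebra.TensorProduct.map (CoalgHom.id k (A ⊗[k] A))
    (Coalgebra.TensorProduct.map h.actHom (CoalgHom.id k H))).comp <|
  (Coalgebra.TensorProduct.map (CoalgHom.id k (A ⊗[k] A))
    ((Coalgebra.TensorProduct.assoc k k H A H).symm : _ →ₗc[k] _)).comp <|
  (interchange k A H A (A ⊗[k] H)).comp <|
    Coalgebra.TensorProduct.map (CoalgHom.id k (A ⊗[k] H))
      ((Coalgebra.TensorProduct.assoc k k A A H : _ →ₗc[k] _).comp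
        (Coalgebra.TensorProduct.map (Coalgebra.comulCoalgHom k A) (CoalgHom.id k H)))

@[simp]
theorem smashMul_comp_pair [Coalgebra.IsCocomm k A] (a b : C →ₗc[k] A) (x y : C →ₗc[k] H) :
    h.smashMul.comp (pair (pair a x) (pair b y)) =
      pair (hA.conv a b) (hH.conv (h.act x b) y) := by
  simp [smashMul, CoalgHom.comp_assoc]

theorem smashMul_tmul [Coalgebra.IsCocomm k A] (a b : A) (x y : H) :
    h.smashMul ((a ⊗ₜ x) ⊗ₜ (b ⊗ₜ y)) =
      sandwich k hA.mul hH.mul ((a ⊗ₜ rsmashEl ract x b) ⊗ₜ y) := by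
  have key : ∀ t : A ⊗[k] A,
      Coalgebra.TensorProduct.map hA.mulHom hH.mulHom
        (Coalgebra.TensorProduct.map (CoalgHom.id k (A ⊗[k] A))
          (Coalgebra.TensorProduct.map h.actHom (CoalgHom.id k H))
          (Coalgebra.TensorProduct.map (CoalgHom.id k (A ⊗[k] A))
            ((Coalgebra.TensorProduct.assoc k k H A H).symm : _ →ₗc[k] _)
            (interchange k A H A (A ⊗[k] H)
              ((a ⊗ₜ x) ⊗ₜ (Coalgebra.TensorProduct.assoc k k A A H (t ⊗ₜ y)))))) =
      sandwich k hA.mul hH.mul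
        ((a ⊗ₜ lTensor A ract (TensorProduct.leftComm k H A A (x ⊗ₜ t))) ⊗ₜ y) := by
    intro t
    induction t with
    | zero => simp
    | add s t hs ht => simp only [add_tmul, tmul_add, map_add, hs, ht]
    | tmul b₁ b₂ => rfl
  exact key (comul b)

end IsRightModuleBialgebra

theorem act_dot_conv [Coalgebra.IsCocomm k H] {BA : HopfBrace k A} {hH : HopfStr k H}
    {ract : H ⊗[k] A →ₗ[k] H}
    (h : IsRightModuleBialgebra BA.circ hH ract)
    (hdot : ∀ (x : H) (a a' : A),
      ract (x ⊗ₜ[k] BA.dot.mul (a ⊗ₜ[k] a')) =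
        hH.mul (rTensor H hH.mul
          (TensorProduct.map
            (TensorProduct.map (ract ∘ₗ (TensorProduct.mk k H A).flip a) hH.antipode)
            (ract ∘ₗ (TensorProduct.mk k H A).flip a')
            (rTensor H (Coalgebra.comul (R := k)) (Coalgebra.comul (R := k) x)))))
    (x : C →ₗc[k] H) (a b : C →ₗc[k] A) :
    h.act x (BA.dot.conv a b) =
      hH.conv (hH.conv (h.act x a) (hH.antipodeHom.comp x)) (h.act x b) := by
  have key : h.actHom.comp
      (Coalgebra.TensorProduct.map (CoalgHom.id k H) BA.dot.mulHom) =
      (hH.mulHom.comp (Coalgebra.TensorProduct.map hH.mulHom (CoalgHom.id k H))).comp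
        ((Coalgebra.TensorProduct.map
          (Coalgebra.TensorProduct.map h.actHom hH.antipodeHom)
          h.actHom).comp (spread k H A)) := by
    refine coalgHom_ext_linear (TensorProduct.ext (LinearMap.ext fun x =>
      TensorProduct.ext' fun a b => (hdot x a b).trans ?_))
    have aux : ∀ t : (H ⊗[k] H) ⊗[k] H,
        hH.mul (rTensor H hH.mul
          (TensorProduct.map
            (TensorProduct.map (ract ∘ₗ (TensorProduct.mk k H A).flip a) hH.antipode)
            (ract ∘ₗ (TensorProduct.mk k H A).flip b) t)) =
        hH.mul (rTensor H hH.mul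
          (TensorProduct.map (TensorProduct.map ract hH.antipode) ract
            (spreadAux k H A (t ⊗ₜ (a ⊗ₜ b))))) := by
      intro t
      induction t with
      | zero => simp
      | add s t hs ht => simp only [add_tmul, map_add, hs, ht]
      | tmul s z =>
      induction s with
      | zero => simp
      | add s t hs ht => simp only [add_tmul, map_add, hs, ht]
      | tmul x y => simp [spreadAux_tmul]
    exact aux _
  simpa [CoalgHom.comp_assoc, spread_comp_pair] using congrArg (·.comp (pair x (pair a b))) key

theorem const_one_tmul_one (hA : HopfStr k A) (hH : HopfStr k H)
    (hΔ : comul (R := k) (hA.one ⊗ₜ[k] hH.one) = (hA.one ⊗ₜ hH.one) ⊗ₜ (hA.one ⊗ₜ hH.one))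
    (hε : counit (R := k) (hA.one ⊗ₜ[k] hH.one) = 1) :
    const C (hA.one ⊗ₜ hH.one) hΔ hε = pair (hA.unit C) (hH.unit C) :=
  (pair_const_const _ _ _ _ _ _ _ _).symm

/-- The componentwise multiplication on `A ⊗ H` as a coalgebra map. -/
noncomputable def tensorMul (hA : HopfStr k A) (hH : HopfStr k H) :
    (A ⊗[k] H) ⊗[k] (A ⊗[k] H) →ₗc[k] A ⊗[k] H :=
  (Coalgebra.TensorProduct.map hA.mulHom hH.mulHom).comp (interchange k A H A H)

@[simp]
theorem tensorMul_comp_pair (hA : HopfStr k A) (hH : HopfStr k H) (a b : C →ₗc[k] A)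
    (x y : C →ₗc[k] H) :
    (tensorMul hA hH).comp (pair (pair a x) (pair b y)) = pair (hA.conv a b) (hH.conv x y) := by
  simp [tensorMul, CoalgHom.comp_assoc]

variable [Coalgebra.IsCocomm k A] [Coalgebra.IsCocomm k H]

variable (C A H) in
theorem forall_coalgHom_tensor {P : (C →ₗc[k] A ⊗[k] H) → Prop}
    (h : ∀ (a : C →ₗc[k] A) (x : C →ₗc[k] H), P (pair a x)) (p : C →ₗc[k] A ⊗[k] H) : P p :=
  eq_pair p ▸ h _ _

variable (C) in
theorem tensorMul_assoc (hA : HopfStr k A) (hH : HopfStr k H) (p q r : C →ₗc[k] A ⊗[k] H) :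
    (tensorMul hA hH).comp (pair ((tensorMul hA hH).comp (pair p q)) r) =
      (tensorMul hA hH).comp (pair p ((tensorMul hA hH).comp (pair q r))) := by
  rw [eq_pair p, eq_pair q, eq_pair r]
  simp only [tensorMul_comp_pair, HopfStr.conv_assoc]

/-- The componentwise Hopf structure on `A ⊗ H`. -/
noncomputable def HopfStr.tensor (hA : HopfStr k A) (hH : HopfStr k H) :
    HopfStr k (A ⊗[k] H) := by
  refine HopfStr.ofPoints (tensorMul hA hH) (hA.one ⊗ₜ hH.one)
    (by simp [hA.comul_one, hH.comul_one]) (by simp [hA.counit_one, hH.counit_one])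
    (Coalgebra.TensorProduct.map hA.antipodeHom hH.antipodeHom)
    (tensorMul_assoc (((A ⊗[k] H) ⊗[k] (A ⊗[k] H)) ⊗[k] (A ⊗[k] H)) hA hH)
    (forall_coalgHom_tensor (k := k) (A ⊗[k] H) A H fun a x => ?_)
    (forall_coalgHom_tensor (k := k) (A ⊗[k] H) A H fun a x => ?_)
    (forall_coalgHom_tensor (k := k) (A ⊗[k] H) A H fun a x => ?_)
    (forall_coalgHom_tensor (k := k) (A ⊗[k] H) A H fun a x => ?_)
  all_goals
    rw [const_one_tmul_one]
    simp only [map_comp_pair, tensorMul_comp_pair, unit_conv, conv_unit, antipode_conv,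
      conv_antipode]

theorem HopfStr.tensor_conv (hA : HopfStr k A) (hH : HopfStr k H) (a b : C →ₗc[k] A)
    (x y : C →ₗc[k] H) :
    (hA.tensor hH).conv (pair a x) (pair b y) = pair (hA.conv a b) (hH.conv x y) :=
  tensorMul_comp_pair hA hH a b x y

theorem HopfStr.tensor_antipode_comp (hA : HopfStr k A) (hH : HopfStr k H) (a : C →ₗc[k] A)
    (x : C →ₗc[k] H) :
    (hA.tensor hH).antipodeHom.comp (pair a x) =
      pair (hA.antipodeHom.comp a) (hH.antipodeHom.comp x) :=
  map_comp_pair hA.antipodeHom hH.antipodeHom a x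

namespace IsRightModuleBialgebra

variable {hA : HopfStr k A} {hH : HopfStr k H} {ract : H ⊗[k] A →ₗ[k] H}
  (h : IsRightModuleBialgebra hA hH ract)

variable (C) in
theorem smashMul_assoc (p q r : C →ₗc[k] A ⊗[k] H) :
    h.smashMul.comp (pair (h.smashMul.comp (pair p q)) r) =
      h.smashMul.comp (pair p (h.smashMul.comp (pair q r))) := by
  rw [eq_pair p, eq_pair q, eq_pair r]
  simp only [smashMul_comp_pair, HopfStr.conv_assoc, h.act_conv, h.conv_act]

/-- The smash product Hopf structure on `A ⊗ H`. -/
noncomputable def smash : HopfStr k (A ⊗[k] H) := by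
  refine HopfStr.ofPoints h.smashMul (hA.one ⊗ₜ hH.one)
    (by simp [hA.comul_one, hH.comul_one]) (by simp [hA.counit_one, hH.counit_one])
    (pair (hA.antipodeHom.comp (fst k A H))
      (h.act (hH.antipodeHom.comp (snd k A H)) (hA.antipodeHom.comp (fst k A H))))
    (h.smashMul_assoc (((A ⊗[k] H) ⊗[k] (A ⊗[k] H)) ⊗[k] (A ⊗[k] H)))
    (forall_coalgHom_tensor (k := k) (A ⊗[k] H) A H fun a x => ?_)
    (forall_coalgHom_tensor (k := k) (A ⊗[k] H) A H fun a x => ?_)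
    (forall_coalgHom_tensor (k := k) (A ⊗[k] H) A H fun a x => ?_)
    (forall_coalgHom_tensor (k := k) (A ⊗[k] H) A H fun a x => ?_)
  all_goals rw [const_one_tmul_one]
  · rw [smashMul_comp_pair, h.unit_act, HopfStr.unit_conv, HopfStr.unit_conv]
  · rw [smashMul_comp_pair, h.act_unit, HopfStr.conv_unit, HopfStr.conv_unit]
  · rw [pair_comp, act_comp, CoalgHom.comp_assoc, CoalgHom.comp_assoc, fst_comp_pair,
      snd_comp_pair, smashMul_comp_pair, ← h.act_conv, HopfStr.antipode_conv, h.act_unit,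
      HopfStr.antipode_conv]
  · rw [pair_comp, act_comp, CoalgHom.comp_assoc, CoalgHom.comp_assoc, fst_comp_pair,
      snd_comp_pair, smashMul_comp_pair, ← h.conv_act, HopfStr.conv_antipode,
      HopfStr.conv_antipode, h.unit_act]

theorem smash_conv (a b : C →ₗc[k] A) (x y : C →ₗc[k] H) :
    h.smash.conv (pair a x) (pair b y) = pair (hA.conv a b) (hH.conv (h.act x b) y) :=
  h.smashMul_comp_pair a b x y

end IsRightModuleBialgebra

end SemidirectProduct

/-- Corollary `22.00`. Let `(A, ·, ∘)` be a cocommutative Hopf brace and `H` a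
commutative, cocommutative Hopf algebra. If `(H, ◀)` is a right `A∘`-module bialgebra such that
`x ◀ (a·a') = (x₍₁₎ ◀ a)·S(x₍₂₎)·(x₍₃₎ ◀ a')`, then the tensor product coalgebra `A ⊗ H` with
`(a ⊗ x)(b ⊗ y) = a·b ⊗ xy` and `(a ⊗ x) ∘ (b ⊗ y) = (a ∘ b₍₁₎) ⊗ (x ◀ b₍₂₎)y` is a Hopf brace. -/
theorem statement2 {k : Type u} [Field k]
    {A H : Type u} [AddCommGroup A] [Module k A] [Coalgebra k A]
    [AddCommGroup H] [Module k H] [Coalgebra k H]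
    (BA : HopfBrace k A) (hAcocomm : IsCocomm k A) (hH : HopfStr k H)
    (hHcomm : hH.IsComm) (hHcocomm : IsCocomm k H)
    (ract : H ⊗[k] A →ₗ[k] H)
    (hmb : IsRightModuleBialgebra BA.circ hH ract)
    (h146 : ∀ (x : H) (a a' : A),
      ract (x ⊗ₜ[k] BA.dot.mul (a ⊗ₜ[k] a')) =
        hH.mul (rTensor H hH.mul
          (TensorProduct.map
            (TensorProduct.map (ract ∘ₗ (TensorProduct.mk k H A).flip a) hH.antipode)
            (ract ∘ₗ (TensorProduct.mk k H A).flip a')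
            (rTensor H (Coalgebra.comul (R := k)) (Coalgebra.comul (R := k) x))))) :
    ∃ B : HopfBrace k (A ⊗[k] H),
      (∀ (a b : A) (x y : H),
        B.dot.mul ((a ⊗ₜ[k] x) ⊗ₜ[k] (b ⊗ₜ[k] y)) =
          BA.dot.mul (a ⊗ₜ[k] b) ⊗ₜ[k] hH.mul (x ⊗ₜ[k] y)) ∧
      (∀ (a b : A) (x y : H),
        B.circ.mul ((a ⊗ₜ[k] x) ⊗ₜ[k] (b ⊗ₜ[k] y)) =
          sandwich k BA.circ.mul hH.mul ((a ⊗ₜ[k] rsmashEl ract x b) ⊗ₜ[k] y)) := by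
  have := isCocomm_of_isCocomm hAcocomm
  have := isCocomm_of_isCocomm hHcocomm
  refine ⟨HopfBrace.ofPoints (BA.dot.tensor hH) hmb.smash fun p q r => ?_,
    fun a b x y => rfl, fun a b x y => hmb.smashMul_tmul a b x y⟩
  rw [eq_pair p, eq_pair q, eq_pair r]
  simp only [HopfStr.tensor_conv, HopfStr.tensor_antipode_comp, hmb.smash_conv,
    BA.conv_brace, act_dot_conv hmb h146, hH.conv_assoc]
  have := Std.Commutative.mk
    (hH.conv_comm (C := (A ⊗[k] H) ⊗[k] ((A ⊗[k] H) ⊗[k] (A ⊗[k] H))) hHcomm)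
  have := Std.Associative.mk
    (hH.conv_assoc (C := (A ⊗[k] H) ⊗[k] ((A ⊗[k] H) ⊗[k] (A ⊗[k] H))))
  congr 1
  ac_rfl

end HopfBraceNL
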